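/- arXiv:2203.04146 — 3 statements merged into one kernel-verified Lean document; each statement's English description precedes it below -/
import Mathlib

section
/- Plays of a single Moore strategy satisfy ψ₂: For every Moore strategy f : List (Set I) → Set O and every set T of infinite traces with T ⊆ {play(f,v) | v : ℕ → Set I}, T satisfies ψ₂. -/
/- Common setup: input propositions `Inp`, output propositions `Out`,
   Σ = Inp ⊕ Out (disjoint union).  An event is a subset of Σ. -/

namespace RE

abbrev Event (Inp Out : Type*) := Set (Inp ⊕ Out)
abbrev InfTrace (Inp Out : Type*) := ℕ → Event Inp Out
abbrev FinTrace (Inp Out : Type*) := List (Event Inp Out)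
abbrev Hyperproperty (Inp Out : Type*) := Set (Set (InfTrace Inp Out))

variable {Inp Out : Type*} {n k : ℕ}

/-- input part `e ∩ I` of an event -/
def inPart (e : Event Inp Out) : Set Inp := {a | Sum.inl a ∈ e}

/-- output part `e ∩ O` of an event -/
def outPart (e : Event Inp Out) : Set Out := {b | Sum.inr b ∈ e}

/-- the event `i ∪ o` built from an input part and an output part -/
def evt (i : Set Inp) (o : Set Out) : Event Inp Out :=
  Sum.inl '' i ∪ Sum.inr '' o

/-! ### Parallel trace input model with `n` traces.
A prefix (an `n`-tuple of equally long finite traces) is represented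
position-majorly as a list of columns `Fin n → Event`. -/

abbrev PPrefix (Inp Out : Type*) (n : ℕ) := List (Fin n → Event Inp Out)

/-- a continuation function `List ((Set I)^n) → (Set O)^n` -/
abbrev PCont (Inp Out : Type*) (n : ℕ) :=
  List (Fin n → Set Inp) → (Fin n → Set Out)

/-- a prefixed strategy in the parallel model -/
abbrev PStrategy (Inp Out : Type*) (n : ℕ) := PPrefix Inp Out n → PCont Inp Out n

/-- the `i`-th trace of the run induced by prefix `U`, continuation `f`
and input sequence `v`:
`uᵢ · (v(0)ᵢ ∪ f(ε)ᵢ) · (v(1)ᵢ ∪ f(v(0))ᵢ) · …` -/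
def prun (U : PPrefix Inp Out n) (f : PCont Inp Out n)
    (v : ℕ → Fin n → Set Inp) (i : Fin n) : InfTrace Inp Out := fun j =>
  if h : j < U.length then U.get ⟨j, h⟩ i
  else evt (v (j - U.length) i) (f ((List.range (j - U.length)).map v) i)

/-- the set of the `n` traces of the induced run -/
def prunSet (U : PPrefix Inp Out n) (f : PCont Inp Out n)
    (v : ℕ → Fin n → Set Inp) : Set (InfTrace Inp Out) :=
  Set.range (prun U f v)

/-- `σ(U) = f` is winning for `H` (i.e. not losing) -/
def PContWinning (H : Hyperproperty Inp Out) (U : PPrefix Inp Out n)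
    (f : PCont Inp Out n) : Prop :=
  ∀ v : ℕ → Fin n → Set Inp, prunSet U f v ∈ H

/-- `U` is a winning prefix for `H` -/
def PWinningPrefix (H : Hyperproperty Inp Out) (U : PPrefix Inp Out n) : Prop :=
  ∃ f : PCont Inp Out n, PContWinning H U f

/-- `σ` is a winning strategy for `H`: `σ(ε)` is winning and `σ(U)` is
winning for every winning prefix `U` -/
def PWinningStrategy (H : Hyperproperty Inp Out) (σ : PStrategy Inp Out n) : Prop :=
  PContWinning H [] (σ []) ∧
  ∀ U : PPrefix Inp Out n, PWinningPrefix H U → PContWinning H U (σ U)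

/-- a reactive system in the parallel model -/
abbrev PSystem (Inp Out : Type*) (n : ℕ) := PCont Inp Out n

/-- the prefix produced by system `S` on the finite input history `s` -/
def psysPrefix (S : PSystem Inp Out n) (s : List (Fin n → Set Inp)) :
    PPrefix Inp Out n :=
  List.ofFn (fun j : Fin s.length => fun i => evt (s.get j i) (S (s.take j) i))

/-- soundness of an enforcement mechanism in the parallel model -/
def PSound (H : Hyperproperty Inp Out)
    (enf : PSystem Inp Out n → PSystem Inp Out n) : Prop :=
  ∀ (S : PSystem Inp Out n) (v : ℕ → Fin n → Set Inp),
    prunSet [] (enf S) v ∈ H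

/-- `U` is output-safe for `H`: replacing the input part of the `j`-th
event by any input tuple (keeping the output parts, truncating after `j`)
yields a winning prefix -/
def POutputSafe (H : Hyperproperty Inp Out) (U : PPrefix Inp Out n) : Prop :=
  ∀ (j : ℕ) (h : j < U.length) (i : Fin n → Set Inp),
    PWinningPrefix H
      (U.take j ++ [fun r => evt (i r) (outPart (U.get ⟨j, h⟩ r))])

/-- transparency of an enforcement mechanism in the parallel model -/
def PTransparent (H : Hyperproperty Inp Out)
    (enf : PSystem Inp Out n → PSystem Inp Out n) : Prop :=
  ∀ (S : PSystem Inp Out n) (s s' : List (Fin n → Set Inp)), s <+: s' →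
    POutputSafe H (psysPrefix S s) →
    psysPrefix S s <+: psysPrefix (enf S) s'

/-- the tuple of length-`m` prefixes of an `n`-tuple of infinite traces -/
def ptracePrefix (t : Fin n → InfTrace Inp Out) (m : ℕ) : PPrefix Inp Out n :=
  List.ofFn (fun j : Fin m => fun i => t i (j : ℕ))

/-- `H` has losing counterexamples in the parallel model with `n` traces -/
def PLosingCounterexamples (H : Hyperproperty Inp Out) (n : ℕ) : Prop :=
  ∀ t : Fin n → InfTrace Inp Out,
    (∀ m : ℕ, PWinningPrefix H (ptracePrefix t m)) → Set.range t ∈ H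

/-! ### Sequential trace input model. -/

/-- a prefixed strategy in the sequential model -/
abbrev SeqStrategy (Inp Out : Type*) :=
  List (InfTrace Inp Out) → FinTrace Inp Out → List (Set Inp) → Set Out

/-- the session trace `u · (v(0) ∪ g(ε)) · (v(1) ∪ g(v(0))) · …` -/
def seqSession (g : List (Set Inp) → Set Out) (u : FinTrace Inp Out)
    (v : ℕ → Set Inp) : InfTrace Inp Out := fun j =>
  if h : j < u.length then u.get ⟨j, h⟩
  else evt (v (j - u.length)) (g ((List.range (j - u.length)).map v))

/-- the induced run `t₀, t₁, …` of strategy `σ` from prefix `(U,u)`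
on session inputs `V` -/
def seqRun (σ : SeqStrategy Inp Out) (U : List (InfTrace Inp Out))
    (u : FinTrace Inp Out) (V : ℕ → ℕ → Set Inp) : ℕ → InfTrace Inp Out
  | 0 => seqSession (σ U u) u (V 0)
  | (m + 1) =>
      seqSession
        (σ (U ++ List.ofFn (fun r : Fin (m + 1) => seqRun σ U u V r.val)) [])
        [] (V (m + 1))
  termination_by m => m
  decreasing_by exact r.isLt

/-- the trace set `{t | t ∈ U} ∪ {t₀, t₁, …}` of the induced run -/
def seqRunSet (σ : SeqStrategy Inp Out) (U : List (InfTrace Inp Out))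
    (u : FinTrace Inp Out) (V : ℕ → ℕ → Set Inp) : Set (InfTrace Inp Out) :=
  {t | t ∈ U} ∪ Set.range (seqRun σ U u V)

/-- `σ` is winning with `(U,u)` for `H` (i.e. not losing) -/
def SeqWinningWith (H : Hyperproperty Inp Out) (σ : SeqStrategy Inp Out)
    (U : List (InfTrace Inp Out)) (u : FinTrace Inp Out) : Prop :=
  ∀ V : ℕ → ℕ → Set Inp, seqRunSet σ U u V ∈ H

/-- `(U,u)` is a winning prefix for `H` -/
def SeqWinningPrefix (H : Hyperproperty Inp Out) (U : List (InfTrace Inp Out))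
    (u : FinTrace Inp Out) : Prop :=
  ∃ σ : SeqStrategy Inp Out, SeqWinningWith H σ U u

/-- `σ` is a winning strategy for `H`: winning with `([],ε)` and with
every winning prefix -/
def SeqWinningStrategy (H : Hyperproperty Inp Out) (σ : SeqStrategy Inp Out) : Prop :=
  SeqWinningWith H σ [] [] ∧
  ∀ (U : List (InfTrace Inp Out)) (u : FinTrace Inp Out),
    SeqWinningPrefix H U u → SeqWinningWith H σ U u

/-- a reactive system in the sequential model: it sees the input sequences
of the completed sessions and the input history of the current session -/
abbrev SeqSystem (Inp Out : Type*) :=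
  List (ℕ → Set Inp) → List (Set Inp) → Set Out

/-- the trace of one session of system `S` after completed session
inputs `prev`, on session input `v` -/
def seqSysSession (S : SeqSystem Inp Out) (prev : List (ℕ → Set Inp))
    (v : ℕ → Set Inp) : InfTrace Inp Out := fun j =>
  evt (v j) (S prev ((List.range j).map v))

/-- the `m`-th trace of the run of system `S` on session inputs `V` -/
def seqSysRun (S : SeqSystem Inp Out) (V : ℕ → ℕ → Set Inp) (m : ℕ) :
    InfTrace Inp Out :=
  seqSysSession S ((List.range m).map V) (V m)

/-- the sequential prefix produced by system `S` on completed session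
inputs `Vs` and current-session input history `s` -/
def seqSysPrefix (S : SeqSystem Inp Out) (Vs : List (ℕ → Set Inp))
    (s : List (Set Inp)) : List (InfTrace Inp Out) × FinTrace Inp Out :=
  (List.ofFn (fun m : Fin Vs.length => seqSysSession S (Vs.take m) (Vs.get m)),
   List.ofFn (fun j : Fin s.length => evt (s.get j) (S Vs (s.take j))))

/-- soundness of an enforcement mechanism in the sequential model -/
def SeqSound (H : Hyperproperty Inp Out)
    (enf : SeqSystem Inp Out → SeqSystem Inp Out) : Prop :=
  ∀ (S : SeqSystem Inp Out) (V : ℕ → ℕ → Set Inp),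
    Set.range (seqSysRun (enf S) V) ∈ H

/-- length-`j` prefix of an infinite trace as a finite trace -/
def finPrefOf (t : InfTrace Inp Out) (j : ℕ) : FinTrace Inp Out :=
  List.ofFn (fun r : Fin j => t r.val)

/-- `(U,u)` is output-safe for `H`: replacing the input part of any event
of the run by any input (keeping output parts, truncating right after that
event) yields a winning prefix -/
def SeqOutputSafe (H : Hyperproperty Inp Out) (U : List (InfTrace Inp Out))
    (u : FinTrace Inp Out) : Prop :=
  (∀ (m : ℕ) (h : m < U.length) (j : ℕ) (i : Set Inp),
    SeqWinningPrefix H (U.take m)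
      (finPrefOf (U.get ⟨m, h⟩) j ++ [evt i (outPart (U.get ⟨m, h⟩ j))])) ∧
  (∀ (j : ℕ) (h : j < u.length) (i : Set Inp),
    SeqWinningPrefix H U (u.take j ++ [evt i (outPart (u.get ⟨j, h⟩))]))

/-- the sequential prefix relation `(U,u) ⪯ (V,v)` -/
def SeqPrefixRel (p q : List (InfTrace Inp Out) × FinTrace Inp Out) : Prop :=
  (p.1 = q.1 ∧ p.2 <+: q.2) ∨
  (p.1.length < q.1.length ∧ q.1.take p.1.length = p.1 ∧
    ∀ (j : ℕ) (h : j < p.2.length),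
      p.2.get ⟨j, h⟩ = q.1.getD p.1.length (fun _ => (∅ : Event Inp Out)) j)

/-- the analogous prefix relation on session inputs -/
def SeqInputPrefixRel (p q : List (ℕ → Set Inp) × List (Set Inp)) : Prop :=
  (p.1 = q.1 ∧ p.2 <+: q.2) ∨
  (p.1.length < q.1.length ∧ q.1.take p.1.length = p.1 ∧
    ∀ (j : ℕ) (h : j < p.2.length),
      p.2.get ⟨j, h⟩ = q.1.getD p.1.length (fun _ => (∅ : Set Inp)) j)

/-- transparency of an enforcement mechanism in the sequential model -/
def SeqTransparent (H : Hyperproperty Inp Out)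
    (enf : SeqSystem Inp Out → SeqSystem Inp Out) : Prop :=
  ∀ (S : SeqSystem Inp Out) (Vs : List (ℕ → Set Inp)) (s : List (Set Inp))
    (Vs' : List (ℕ → Set Inp)) (s' : List (Set Inp)),
    SeqInputPrefixRel (Vs, s) (Vs', s') →
    SeqOutputSafe H (seqSysPrefix S Vs s).1 (seqSysPrefix S Vs s).2 →
    SeqPrefixRel (seqSysPrefix S Vs s) (seqSysPrefix (enf S) Vs' s')

/-- `H` has losing counterexamples in the sequential model -/
def SeqLosingCounterexamples (H : Hyperproperty Inp Out) : Prop :=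
  ∀ t : ℕ → InfTrace Inp Out,
    (∀ (m j : ℕ),
      SeqWinningPrefix H (List.ofFn (fun r : Fin m => t r.val)) (finPrefOf (t m) j)) →
    Set.range t ∈ H

/-! ### Quantifier-free HyperLTL with trace variables from `Fin k`. -/

inductive HForm (α : Type*) (k : ℕ) : Type _
  | tt : HForm α k
  | atom : α → Fin k → HForm α k
  | neg : HForm α k → HForm α k
  | disj : HForm α k → HForm α k → HForm α k
  | next : HForm α k → HForm α k
  | until_ : HForm α k → HForm α k → HForm α k

/-- semantics of quantifier-free HyperLTL w.r.t. a trace assignment -/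
def HSat {α : Type*} : HForm α k → (Fin k → (ℕ → Set α)) → ℕ → Prop
  | .tt, _, _ => True
  | .atom a p, A, j => a ∈ A p j
  | .neg φ, A, j => ¬ HSat φ A j
  | .disj φ ψ, A, j => HSat φ A j ∨ HSat ψ A j
  | .next φ, A, j => HSat φ A (j + 1)
  | .until_ φ ψ, A, j =>
      ∃ m, j ≤ m ∧ HSat ψ A m ∧ ∀ l, j ≤ l → l < m → HSat φ A l

/-- `T ⊨ ∀π₁…∀πₖ. φ` -/
def SatForall {α : Type*} (T : Set (ℕ → Set α)) (φ : HForm α k) : Prop :=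
  ∀ A : Fin k → (ℕ → Set α), (∀ p, A p ∈ T) → HSat φ A 0

namespace HForm

def conj {α : Type*} (φ ψ : HForm α k) : HForm α k := .neg (.disj (.neg φ) (.neg ψ))

def iff_ {α : Type*} (φ ψ : HForm α k) : HForm α k :=
  conj (.disj (.neg φ) ψ) (.disj (.neg ψ) φ)

def always {α : Type*} (φ : HForm α k) : HForm α k := .neg (.until_ .tt (.neg φ))

/-- weak until `φ W ψ := (φ U ψ) ∨ G φ` -/
def wuntil {α : Type*} (φ ψ : HForm α k) : HForm α k := .disj (.until_ φ ψ) (always φ)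

end HForm

def bigConj {α : Type*} (l : List (HForm α k)) : HForm α k := l.foldr HForm.conj .tt

def bigDisj {α : Type*} (l : List (HForm α k)) : HForm α k :=
  l.foldr HForm.disj (.neg .tt)

/-- the formula `ψ₂ = ∀π.∀π'. (⋀_{o∈O}(o_π ↔ o_{π'})) W (⋁_{i∈I} ¬(i_π ↔ i_{π'}))`
(its quantifier-free matrix with two trace variables) -/
noncomputable def psi2 (Inp Out : Type*) [Fintype Inp] [Fintype Out] : HForm (Inp ⊕ Out) 2 :=
  HForm.wuntil
    (bigConj ((Finset.univ : Finset Out).toList.map (fun o =>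
      HForm.iff_ (.atom (Sum.inr o) 0) (.atom (Sum.inr o) 1))))
    (bigDisj ((Finset.univ : Finset Inp).toList.map (fun i =>
      .neg (HForm.iff_ (.atom (Sum.inl i) 0) (.atom (Sum.inl i) 1)))))

/-- the play of a Moore strategy `f` on an input sequence `v` -/
def play (f : List (Set Inp) → Set Out) (v : ℕ → Set Inp) : InfTrace Inp Out :=
  fun m => evt (v m) (f ((List.range m).map v))

/-- `∀^k φ` is realizable: some Moore strategy's full set of plays satisfies it -/
def Realizable (φ : HForm (Inp ⊕ Out) k) : Prop :=
  ∃ f : List (Set Inp) → Set Out,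
    SatForall (Set.range (fun v : ℕ → Set Inp => play f v)) φ

/-! ### LTL over `Σ × Fin n` and the HyperLTL-to-LTL translation. -/

inductive LTL (β : Type*) : Type _
  | tt : LTL β
  | atom : β → LTL β
  | neg : LTL β → LTL β
  | disj : LTL β → LTL β → LTL β
  | next : LTL β → LTL β
  | until_ : LTL β → LTL β → LTL β

def LSat {β : Type*} : LTL β → (ℕ → Set β) → ℕ → Prop
  | .tt, _, _ => True
  | .atom b, w, j => b ∈ w j
  | .neg φ, w, j => ¬ LSat φ w j
  | .disj φ ψ, w, j => LSat φ w j ∨ LSat ψ w j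
  | .next φ, w, j => LSat φ w (j + 1)
  | .until_ φ ψ, w, j =>
      ∃ m, j ≤ m ∧ LSat ψ w m ∧ ∀ l, j ≤ l → l < m → LSat φ w l

def LTL.conj {β : Type*} (φ ψ : LTL β) : LTL β := .neg (.disj (.neg φ) (.neg ψ))

def lbigConj {β : Type*} (l : List (LTL β)) : LTL β := l.foldr LTL.conj .tt

/-- `φ[ρ]`: replace each atom `a_π` by `(a, ρ(π))` -/
def trLTL {α : Type*} : HForm α k → (Fin k → Fin n) → LTL (α × Fin n)
  | .tt, _ => .tt
  | .atom a p, ρ => .atom (a, ρ p)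
  | .neg φ, ρ => .neg (trLTL φ ρ)
  | .disj φ ψ, ρ => .disj (trLTL φ ρ) (trLTL ψ ρ)
  | .next φ, ρ => .next (trLTL φ ρ)
  | .until_ φ ψ, ρ => .until_ (trLTL φ ρ) (trLTL ψ ρ)

/-- `φ^n_LTL := ⋀_{ρ : Fin k → Fin n} φ[ρ]` -/
noncomputable def phiLTL {α : Type*} (n : ℕ) (φ : HForm α k) : LTL (α × Fin n) :=
  lbigConj ((Finset.univ : Finset (Fin k → Fin n)).toList.map (fun ρ => trLTL φ ρ))

/-- `zip(t₁,…,tₙ)`: `(a,i) ∈ zip(t)(m)` iff `a ∈ tᵢ(m)` -/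
def zipFam {α : Type*} (t : Fin n → (ℕ → Set α)) : ℕ → Set (α × Fin n) :=
  fun m => {p | p.1 ∈ t p.2 m}

/-- event over `Σ × Fin n` built from inputs in `I × Fin n` and
outputs in `O × Fin n` -/
def evtN (i : Set (Inp × Fin n)) (o : Set (Out × Fin n)) :
    Set ((Inp ⊕ Out) × Fin n) :=
  {p | (∃ a, p.1 = Sum.inl a ∧ (a, p.2) ∈ i) ∨ (∃ b, p.1 = Sum.inr b ∧ (b, p.2) ∈ o)}

end RE

namespace RE

theorem hSat_conj {α : Type*} {k : ℕ} (φ ψ : HForm α k) (A : Fin k → (ℕ → Set α)) (j : ℕ) :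
    HSat (HForm.conj φ ψ) A j ↔ HSat φ A j ∧ HSat ψ A j := by
  simp [HForm.conj, HSat]

theorem hSat_iff {α : Type*} {k : ℕ} (φ ψ : HForm α k) (A : Fin k → (ℕ → Set α)) (j : ℕ) :
    HSat (HForm.iff_ φ ψ) A j ↔ (HSat φ A j ↔ HSat ψ A j) := by
  simp only [HForm.iff_, hSat_conj, HSat]
  tauto

theorem hSat_always {α : Type*} {k : ℕ} (φ : HForm α k) (A : Fin k → (ℕ → Set α)) (j : ℕ) :
    HSat (HForm.always φ) A j ↔ ∀ m, j ≤ m → HSat φ A m := by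
  simp [HForm.always, HSat]

theorem hSat_bigConj {α : Type*} {k : ℕ} (l : List (HForm α k)) (A : Fin k → (ℕ → Set α))
    (j : ℕ) : HSat (bigConj l) A j ↔ ∀ φ ∈ l, HSat φ A j := by
  induction l with
  | nil => simp [bigConj, HSat]
  | cons φ l ih =>
    rw [List.forall_mem_cons, ← ih]
    exact hSat_conj φ (bigConj l) A j

theorem hSat_bigDisj {α : Type*} {k : ℕ} (l : List (HForm α k)) (A : Fin k → (ℕ → Set α))
    (j : ℕ) : HSat (bigDisj l) A j ↔ ∃ φ ∈ l, HSat φ A j := by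
  induction l with
  | nil => simp [bigDisj, HSat]
  | cons φ l ih =>
    rw [List.exists_mem_cons_iff, ← ih]
    rfl

/-- Weak until holds as soon as `φ` can only fail strictly after some occurrence of `ψ`. -/
theorem hSat_wuntil_of_forall {α : Type*} {k : ℕ} (φ ψ : HForm α k)
    (A : Fin k → (ℕ → Set α))
    (h : ∀ m, (∀ l < m, ¬ HSat ψ A l) → HSat φ A m) : HSat (HForm.wuntil φ ψ) A 0 := by
  classical
  by_cases hex : ∃ m, HSat ψ A m
  · exact Or.inl ⟨Nat.find hex, Nat.zero_le _, Nat.find_spec hex, fun l _ hl =>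
      h l fun l' hl' => Nat.find_min hex (hl'.trans hl)⟩
  · push Not at hex
    exact Or.inr ((hSat_always φ A 0).2 fun m _ => h m fun l _ => hex l)

theorem inl_mem_play {Inp Out : Type*} (f : List (Set Inp) → Set Out) (v : ℕ → Set Inp)
    (m : ℕ) (i : Inp) : Sum.inl i ∈ play f v m ↔ i ∈ v m := by
  simp [play, evt]

theorem inr_mem_play {Inp Out : Type*} (f : List (Set Inp) → Set Out) (v : ℕ → Set Inp)
    (m : ℕ) (o : Out) : Sum.inr o ∈ play f v m ↔ o ∈ f ((List.range m).map v) := by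
  simp [play, evt]

end RE

open RE in
/-- Plays of a single Moore strategy satisfy ψ₂. -/
theorem plays_satisfy_psi2
    {Inp Out : Type*} [Fintype Inp] [Fintype Out]
    (f : List (Set Inp) → Set Out) (T : Set (InfTrace Inp Out))
    (hT : T ⊆ Set.range (fun v : ℕ → Set Inp => play f v)) :
    SatForall T (psi2 Inp Out) := by
  intro A hA
  obtain ⟨v, hv⟩ := hT (hA 0)
  obtain ⟨w, hw⟩ := hT (hA 1)
  dsimp only at hv hw
  refine hSat_wuntil_of_forall _ _ A fun m hm => ?_
  have hvw : (List.range m).map v = (List.range m).map w := by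
    refine List.map_congr_left fun l hl => Set.ext fun i => ?_
    have hl' := hm l (List.mem_range.1 hl)
    simp only [hSat_bigDisj, List.mem_map, Finset.mem_toList, Finset.mem_univ, true_and,
      exists_exists_eq_and, HSat, hSat_iff, not_exists, not_not, ← hv, ← hw,
      inl_mem_play] at hl'
    exact hl' i
  simp only [hSat_bigConj, List.mem_map, Finset.mem_toList, Finset.mem_univ, true_and,
    forall_exists_index, forall_apply_eq_imp_iff, hSat_iff, HSat, ← hv, ← hw,
    inr_mem_play, hvw, implies_true]
end

section
/- Losing prefixes in the parallel model correspond to non-realizability of the LTL translation with prefix: Let φ be a quantifier-free HyperLTL formula over Σ with trace variables from Fin k and H(∀^k φ) := {T | T ⊨ ∀^k φ}. A prefix U = (u₁,…,uₙ) of finite traces of equal length is losing for H(∀^k φ) in the parallel model with n traces if and only if there is no function g : List ((Set I)^n) → (Set O)^n such that for every v : ℕ → (Set I)^n the zipped infinite trace of the run that continues each component uᵢ with the events v(j)ᵢ ∪ g(v(0),…,v(j−1))ᵢ satisfies φ^n_LTL. -/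
namespace RE

theorem LSat_conj {β : Type*} (φ ψ : LTL β) (w : ℕ → Set β) (j : ℕ) :
    LSat (φ.conj ψ) w j ↔ LSat φ w j ∧ LSat ψ w j := by
  simp only [LTL.conj, LSat, not_or, not_not]

theorem LSat_lbigConj {β : Type*} (l : List (LTL β)) (w : ℕ → Set β) (j : ℕ) :
    LSat (lbigConj l) w j ↔ ∀ φ ∈ l, LSat φ w j := by
  induction l with
  | nil => simp [lbigConj, LSat]
  | cons φ l ih =>
    rw [List.forall_mem_cons, ← ih]
    exact LSat_conj _ _ _ _

theorem LSat_trLTL {α : Type*} {n k : ℕ} (φ : HForm α k) (ρ : Fin k → Fin n)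
    (t : Fin n → (ℕ → Set α)) (j : ℕ) :
    LSat (trLTL φ ρ) (zipFam t) j ↔ HSat φ (t ∘ ρ) j := by
  induction φ generalizing j with
  | tt => rfl
  | atom a p => rfl
  | neg φ ih => simp only [trLTL, LSat, HSat, ih]
  | disj φ ψ ihφ ihψ => simp only [trLTL, LSat, HSat, ihφ, ihψ]
  | next φ ih => simp only [trLTL, LSat, HSat, ih]
  | until_ φ ψ ihφ ihψ => simp only [trLTL, LSat, HSat, ihφ, ihψ]

theorem satForall_range_iff {α ι : Type*} {k : ℕ} (φ : HForm α k) (t : ι → (ℕ → Set α)) :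
    SatForall (Set.range t) φ ↔ ∀ ρ : Fin k → ι, HSat φ (t ∘ ρ) 0 := by
  refine ⟨fun h ρ => h _ fun p => ⟨ρ p, rfl⟩, fun h A hA => ?_⟩
  choose ρ hρ using hA
  obtain rfl : t ∘ ρ = A := funext hρ
  exact h ρ

/-- A family of `n` traces satisfies `∀^k φ` iff its zipping satisfies `φ^n_LTL`. -/
theorem LSat_phiLTL_zipFam {α : Type*} {n k : ℕ} (φ : HForm α k) (t : Fin n → (ℕ → Set α)) :
    LSat (phiLTL n φ) (zipFam t) 0 ↔ SatForall (Set.range t) φ := by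
  simp [phiLTL, LSat_lbigConj, LSat_trLTL, satForall_range_iff]

end RE

open RE in
/-- Losing prefixes in the parallel model correspond to non-realizability
of the LTL translation with prefix. -/
theorem losing_prefix_iff_not_realizable_with_prefix
    {Inp Out : Type*} {k n : ℕ} (φ : HForm (Inp ⊕ Out) k)
    (U : PPrefix Inp Out n) :
    ¬ PWinningPrefix {T : Set (InfTrace Inp Out) | SatForall T φ} U ↔
      ¬ ∃ g : PCont Inp Out n, ∀ v : ℕ → Fin n → Set Inp,
          LSat (phiLTL n φ) (zipFam (fun i => prun U g v i)) 0 := by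
  simp only [LSat_phiLTL_zipFam]
  rfl
end

section
/- Realizability correspondence for the parallel model: Let φ be a quantifier-free HyperLTL formula over Σ with trace variables from Fin k and H(∀^k φ) := {T | T ⊨ ∀^k φ}. The empty prefix (ε,…,ε) is winning for H(∀^k φ) in the parallel model with n traces if and only if φ^n_LTL is realizable as an LTL formula with inputs I × Fin n and outputs O × Fin n, i.e., iff there exists h : List (Set (I × Fin n)) → Set (O × Fin n) such that for every v : ℕ → Set (I × Fin n) the infinite trace m ↦ v(m) ∪ h(v(0),…,v(m−1)) satisfies φ^n_LTL. -/
namespace RE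

variable {Inp Out α β : Type*} {n k : ℕ}

/-- Zipping a tuple of sets into a single set of indexed elements. -/
def tupleEquiv (α : Type*) (n : ℕ) : (Fin n → Set α) ≃ Set (α × Fin n) where
  toFun s := {p | p.1 ∈ s p.2}
  invFun s i := {a | (a, i) ∈ s}
  left_inv _ := rfl
  right_inv _ := rfl

theorem lSat_conj (φ ψ : LTL β) (w : ℕ → Set β) (j : ℕ) :
    LSat (φ.conj ψ) w j ↔ LSat φ w j ∧ LSat ψ w j := by
  simp [LTL.conj, LSat]

theorem lSat_lbigConj (l : List (LTL β)) (w : ℕ → Set β) (j : ℕ) :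
    LSat (lbigConj l) w j ↔ ∀ φ ∈ l, LSat φ w j := by
  induction l with
  | nil => simp [lbigConj, LSat]
  | cons φ l ih =>
    rw [List.forall_mem_cons, ← ih]
    exact lSat_conj φ (lbigConj l) w j

theorem lSat_trLTL_zipFam (φ : HForm α k) (ρ : Fin k → Fin n) (t : Fin n → ℕ → Set α) (j : ℕ) :
    LSat (trLTL φ ρ) (zipFam t) j ↔ HSat φ (t ∘ ρ) j := by
  induction φ generalizing j with
  | tt => rfl
  | atom a p => rfl
  | neg φ ih => simp only [trLTL, LSat, HSat, ih]
  | disj φ ψ ihφ ihψ => simp only [trLTL, LSat, HSat, ihφ, ihψ]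
  | next φ ih => simp only [trLTL, LSat, HSat, ih]
  | until_ φ ψ ihφ ihψ => simp only [trLTL, LSat, HSat, ihφ, ihψ]

theorem satForall_range (φ : HForm α k) (t : Fin n → ℕ → Set α) :
    SatForall (Set.range t) φ ↔ ∀ ρ : Fin k → Fin n, HSat φ (t ∘ ρ) 0 := by
  refine ⟨fun h ρ => h _ fun p => ⟨ρ p, rfl⟩, fun h A hA => ?_⟩
  choose ρ hρ using hA
  obtain rfl : t ∘ ρ = A := funext hρ
  exact h ρ

theorem lSat_phiLTL_zipFam (φ : HForm α k) (t : Fin n → ℕ → Set α) :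
    LSat (phiLTL n φ) (zipFam t) 0 ↔ SatForall (Set.range t) φ := by
  simp [phiLTL, lSat_lbigConj, satForall_range, lSat_trLTL_zipFam]

theorem zipFam_prun_nil (f : PCont Inp Out n) (v : ℕ → Fin n → Set Inp) :
    zipFam (prun [] f v) = fun m =>
      evtN (tupleEquiv Inp n (v m)) (tupleEquiv Out n (f ((List.range m).map v))) := by
  ext m ⟨a, i⟩
  cases a <;> simp [zipFam, prun, evt, evtN, tupleEquiv]

theorem satForall_prunSet_nil (φ : HForm (Inp ⊕ Out) k) (f : PCont Inp Out n)
    (v : ℕ → Fin n → Set Inp) :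
    SatForall (prunSet [] f v) φ ↔
      LSat (phiLTL n φ) (fun m =>
        evtN (tupleEquiv Inp n (v m)) (tupleEquiv Out n (f ((List.range m).map v)))) 0 := by
  rw [← zipFam_prun_nil, lSat_phiLTL_zipFam, prunSet]

end RE

open RE in
/-- Realizability correspondence for the parallel model. -/
theorem empty_parallel_prefix_winning_iff_ltl_realizable
    {Inp Out : Type*} {k n : ℕ} (φ : HForm (Inp ⊕ Out) k) :
    PWinningPrefix {T : Set (InfTrace Inp Out) | SatForall T φ}
        ([] : PPrefix Inp Out n) ↔
      ∃ h : List (Set (Inp × Fin n)) → Set (Out × Fin n),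
        ∀ v : ℕ → Set (Inp × Fin n),
          LSat (phiLTL n φ)
            (fun m => evtN (v m) (h ((List.range m).map v))) 0 := by
  constructor
  · rintro ⟨f, hf⟩
    refine ⟨fun l => tupleEquiv Out n (f (l.map (tupleEquiv Inp n).symm)), fun v => ?_⟩
    have h := (satForall_prunSet_nil φ f _).1 (hf fun m => (tupleEquiv Inp n).symm (v m))
    simpa [Function.comp_def] using h
  · rintro ⟨h, hh⟩
    refine ⟨fun l => (tupleEquiv Out n).symm (h (l.map (tupleEquiv Inp n))), fun v => ?_⟩
    refine (satForall_prunSet_nil φ _ v).2 ?_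
    simpa [Function.comp_def] using hh fun m => tupleEquiv Inp n (v m)
end
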